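/- There is the following high-probability boundedness-improvement statement. Let n₁, n₂, n₃ ≥ 2 be integers with n_max = max{n₁,n₂,n₃}, let r ≥ 1, μ ≥ 1, B > 0, C ≥ 1, β > 0 with μr ≤ min{n₁,n₂,n₃}, and suppose m satisfies m > 10000·C·(2+β)²·n_max·r·μ²·ln(n_max) and m > 10000·C·(2+β)²·r·√(n₁)·max{n₂,n₃}·μ^{3/2}·ln(n_max) and m ≤ n₁n₂n₃. Let {u_i}_{i=1}^r ⊂ ℝ^{n₁}, {v_i}_{i=1}^r ⊂ ℝ^{n₂}, {w_i}_{i=1}^r ⊂ ℝ^{n₃} be orthonormal sets of μ-incoherent vectors, and let P = P_UV + P_UW + P_VW − 2·P_UVW. Let A be a fixed (B,r,μ)-bounded n₁×n₂×n₃ tensor and let Ω ⊆ [n₁]×[n₂]×[n₃] be random with each triple included independently with probability m/(n₁n₂n₃) (Ω chosen independently of A). Then Pr[P(R̄_Ω A) is not (B/C, r, μ)-bounded] < 100·n_max^{−(β+1)}. -/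

import Mathlib

open scoped BigOperators ENNReal
open MeasureTheory

/-- The Bernoulli measure on `Bool` with success probability `p`. -/
noncomputable def bern (p : ℝ≥0∞) : Measure Bool :=
  p • Measure.dirac true + (1 - p) • Measure.dirac false

/-- An `n₁ × n₂ × n₃` tensor `A` is `(B, r, μ)`-bounded. -/
def IsBdd (n₁ n₂ n₃ : ℕ) (A : Fin n₁ → Fin n₂ → Fin n₃ → ℝ) (B r μ : ℝ) : Prop :=
  (∀ a b c, (A a b c) ^ 2 ≤ B * r) ∧
  (∀ b c, (1 / n₁ : ℝ) * (∑ a, (A a b c) ^ 2) ≤ B / μ) ∧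
  (∀ a c, (1 / n₂ : ℝ) * (∑ b, (A a b c) ^ 2) ≤ B / μ) ∧
  (∀ a b, (1 / n₃ : ℝ) * (∑ c, (A a b c) ^ 2) ≤ B / μ) ∧
  (∀ c, (1 / (n₁ * n₂) : ℝ) * (∑ a, ∑ b, (A a b c) ^ 2) ≤ B / μ ^ 2) ∧
  (∀ b, (1 / (n₁ * n₃) : ℝ) * (∑ a, ∑ c, (A a b c) ^ 2) ≤ B / μ ^ 2) ∧
  (∀ a, (1 / (n₂ * n₃) : ℝ) * (∑ b, ∑ c, (A a b c) ^ 2) ≤ B / μ ^ 2) ∧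
  ((1 / (n₁ * n₂ * n₃) : ℝ) * (∑ a, ∑ b, ∑ c, (A a b c) ^ 2) ≤ B / μ ^ 3)


theorem cosh_key (a b q s : ℝ) (hs : |s| ≤ 1) (hq : q ^ 2 = a ^ 2 + b ^ 2 + 2 * a * b * s) :
    Real.cosh q ≤ Real.cosh a * Real.cosh b + s * (Real.sinh a * Real.sinh b) := by
  have e : Real.cosh a * Real.cosh b + s * (Real.sinh a * Real.sinh b) =
      (1 + s) / 2 * Real.cosh (a + b) + (1 - s) / 2 * Real.cosh (a - b) := by
    rw [Real.cosh_add, Real.cosh_sub]; ring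
  rw [e]
  obtain ⟨hs1, hs2⟩ := abs_le.1 hs
  refine hasSum_le (fun k => ?_) (Real.hasSum_cosh q)
    (((Real.hasSum_cosh (a + b)).mul_left ((1 + s) / 2)).add
      ((Real.hasSum_cosh (a - b)).mul_left ((1 - s) / 2)))
  have hcv : ConvexOn ℝ (Set.Ici 0) fun x : ℝ => x ^ k := convexOn_pow k
  have h := hcv.2 (Set.mem_Ici.2 (sq_nonneg (a + b))) (Set.mem_Ici.2 (sq_nonneg (a - b)))
    (by linarith : 0 ≤ (1 + s) / 2) (by linarith : 0 ≤ (1 - s) / 2) (by ring)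
  simp only [smul_eq_mul] at h
  have e2 : (1 + s) / 2 * (a + b) ^ 2 + (1 - s) / 2 * (a - b) ^ 2 = q ^ 2 := by rw [hq]; ring
  rw [e2] at h
  have hk : (0 : ℝ) < ((2 * k).factorial : ℝ) := by positivity
  rw [pow_mul, pow_mul, pow_mul, ← mul_div_assoc, ← mul_div_assoc, ← add_div]
  gcongr

theorem cosh_step {E : Type*} [NormedAddCommGroup E] [InnerProductSpace ℝ E] (x y : E)
    (hy : ‖y‖ ≤ 1) :
    Real.cosh ‖x + y‖ ≤ Real.cosh ‖x‖ * (1 + ‖y‖ ^ 2) +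
      Real.sinh ‖x‖ / ‖x‖ * inner ℝ x y := by
  have hexp : Real.exp ‖y‖ - ‖y‖ ≤ 1 + ‖y‖ ^ 2 := by
    have := Real.abs_exp_sub_one_sub_id_le (x := ‖y‖) (by rwa [abs_norm])
    have := (abs_le.1 this).2
    linarith
  have hcs : Real.exp ‖y‖ = Real.cosh ‖y‖ + Real.sinh ‖y‖ := (Real.cosh_add_sinh _).symm
  have hsb : ‖y‖ ≤ Real.sinh ‖y‖ := Real.self_le_sinh_iff.2 (norm_nonneg _)
  have hca : 0 < Real.cosh ‖x‖ := Real.cosh_pos _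
  have hsa : 0 ≤ Real.sinh ‖x‖ := Real.sinh_nonneg_iff.2 (norm_nonneg _)
  have hsc : Real.sinh ‖x‖ ≤ Real.cosh ‖x‖ := (Real.sinh_lt_cosh _).le
  rcases eq_or_ne x 0 with rfl | hx
  · simp
    nlinarith
  rcases eq_or_ne y 0 with rfl | hy0
  · simp
  have hxn : 0 < ‖x‖ := norm_pos_iff.2 hx
  have hyn : 0 < ‖y‖ := norm_pos_iff.2 hy0
  set s : ℝ := inner ℝ x y / (‖x‖ * ‖y‖) with hsdef
  have hs : |s| ≤ 1 := abs_real_inner_div_norm_mul_norm_le_one x y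
  have hin : inner ℝ x y = s * (‖x‖ * ‖y‖) := by rw [hsdef]; field_simp
  have h := cosh_key ‖x‖ ‖y‖ ‖x + y‖ s hs (by
    rw [norm_add_sq_real, hin]; ring)
  refine h.trans ?_
  have e : Real.sinh ‖x‖ / ‖x‖ * inner ℝ x y = s * (Real.sinh ‖x‖ * ‖y‖) := by
    rw [hin]; field_simp
  rw [e]
  obtain ⟨hs1, hs2⟩ := abs_le.1 hs
  have h1 : s * (Real.sinh ‖x‖ * (Real.sinh ‖y‖ - ‖y‖)) ≤
      1 * (Real.cosh ‖x‖ * (Real.sinh ‖y‖ - ‖y‖)) := by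
    apply mul_le_mul hs2 _ (mul_nonneg hsa (by linarith)) (by norm_num)
    exact mul_le_mul_of_nonneg_right hsc (by linarith)
  have h2 : Real.cosh ‖x‖ * (Real.cosh ‖y‖ + (Real.sinh ‖y‖ - ‖y‖)) ≤
     Real.cosh ‖x‖ * (1 + ‖y‖ ^ 2) := by
    apply mul_le_mul_of_nonneg_left _ hca.le
    linarith
  linarith

theorem bern_step {E : Type*} [NormedAddCommGroup E] [InnerProductSpace ℝ E] (x y : E) (p : ℝ)
    (hp : 0 < p) (hp1 : p ≤ 1) (hy : ‖y‖ ≤ p) :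
    p * Real.cosh ‖(1 / p - 1) • y + x‖ + (1 - p) * Real.cosh ‖(-1 : ℝ) • y + x‖ ≤
      Real.cosh ‖x‖ * (1 + ‖y‖ ^ 2 / p) := by
  have hpi : 1 ≤ 1 / p := by rw [le_div_iff₀ hp]; linarith
  have h1 := cosh_step x ((1 / p - 1) • y) (by
    rw [norm_smul, Real.norm_of_nonneg (by linarith)]
    calc (1 / p - 1) * ‖y‖ ≤ (1 / p) * p := by gcongr; linarith
      _ = 1 := by field_simp)
  have h2 := cosh_step x ((-1 : ℝ) • y) (by
    rw [norm_smul]; simp; linarith)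
  rw [add_comm] at h1 h2
  rw [norm_smul, inner_smul_right, mul_pow, Real.norm_eq_abs, sq_abs] at h1 h2
  have h3 := mul_le_mul_of_nonneg_left h1 hp.le
  have h4 := mul_le_mul_of_nonneg_left h2 (by linarith : 0 ≤ 1 - p)
  have hc : 0 < Real.cosh ‖x‖ := Real.cosh_pos _
  refine (add_le_add h3 h4).trans ?_
  have : p * (Real.cosh ‖x‖ * (1 + (1 / p - 1) ^ 2 * ‖y‖ ^ 2) +
      Real.sinh ‖x‖ / ‖x‖ * ((1 / p - 1) * inner ℝ x y)) +
      (1 - p) * (Real.cosh ‖x‖ * (1 + (-1) ^ 2 * ‖y‖ ^ 2) +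
      Real.sinh ‖x‖ / ‖x‖ * (-1 * inner ℝ x y)) =
      Real.cosh ‖x‖ * (1 + ‖y‖ ^ 2 / p) - Real.cosh ‖x‖ * ‖y‖ ^ 2 := by
    rcases eq_or_ne ‖x‖ 0 with h | h
    · rw [h]; field_simp; ring
    · field_simp; ring
  rw [this]
  have : 0 ≤ Real.cosh ‖x‖ * ‖y‖ ^ 2 := by positivity
  linarith

theorem pow_sum_bound {I : Type*} [DecidableEq I] {E : Type*} [NormedAddCommGroup E]
    [InnerProductSpace ℝ E] (y : I → E) (p : ℝ)
    (hp : 0 < p) (hp1 : p ≤ 1) (hy : ∀ j, ‖y j‖ ≤ p) (s : Finset I) :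
    ∑ S ∈ s.powerset, (∏ j ∈ s, (if j ∈ S then p else 1 - p)) *
      Real.cosh ‖∑ j ∈ s, (if j ∈ S then 1 / p - 1 else -1 : ℝ) • y j‖ ≤
      ∏ j ∈ s, (1 + ‖y j‖ ^ 2 / p) := by
  induction s using Finset.induction_on with
  | empty => simp
  | insert a s ha ih =>
    rw [Finset.sum_powerset_insert ha, ← Finset.sum_add_distrib, Finset.prod_insert ha]
    calc _ ≤ ∑ S ∈ s.powerset, (1 + ‖y a‖ ^ 2 / p) *
          ((∏ j ∈ s, (if j ∈ S then p else 1 - p)) *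
          Real.cosh ‖∑ j ∈ s, (if j ∈ S then 1 / p - 1 else -1 : ℝ) • y j‖) := by
          refine Finset.sum_le_sum fun S hS => ?_
          have haS : a ∉ S := fun h => ha (Finset.mem_powerset.1 hS h)
          have e1 : ∀ j ∈ s, (j ∈ insert a S ↔ j ∈ S) := fun j hj => by
            have : j ≠ a := fun h => ha (h ▸ hj)
            simp [this]
          have e2 : ∏ j ∈ s, (if j ∈ insert a S then p else 1 - p) =
              ∏ j ∈ s, (if j ∈ S then p else 1 - p) :=
            Finset.prod_congr rfl fun j hj => by simp only [e1 j hj]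
          have e3 : ∑ j ∈ s, (if j ∈ insert a S then 1 / p - 1 else -1 : ℝ) • y j =
              ∑ j ∈ s, (if j ∈ S then 1 / p - 1 else -1 : ℝ) • y j :=
            Finset.sum_congr rfl fun j hj => by simp only [e1 j hj]
          rw [Finset.prod_insert ha, Finset.prod_insert ha, Finset.sum_insert ha,
            Finset.sum_insert ha, e2, e3, if_neg haS, if_neg haS,
            if_pos (Finset.mem_insert_self a S), if_pos (Finset.mem_insert_self a S)]
          have := bern_step (∑ j ∈ s, (if j ∈ S then 1 / p - 1 else -1 : ℝ) • y j) (y a) p hp hp1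
            (hy a)
          have hW : 0 ≤ ∏ j ∈ s, (if j ∈ S then p else 1 - p) :=
            Finset.prod_nonneg fun j _ => by split_ifs <;> linarith
          have := mul_le_mul_of_nonneg_left this hW
          linarith
      _ ≤ _ := by
          rw [← Finset.mul_sum]
          exact mul_le_mul_of_nonneg_left ih (by positivity)

theorem bern_prob (p : ℝ) (hp1 : p ≤ 1) :
    IsProbabilityMeasure (bern (ENNReal.ofReal p)) := by
  constructor
  simp only [bern, Measure.add_apply, Measure.smul_apply, smul_eq_mul, measure_univ, mul_one]
  exact add_tsub_cancel_of_le (by simpa using hp1)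

theorem bern_sing (p : ℝ) (hp : 0 < p) (b : Bool) :
    (bern (ENNReal.ofReal p) {b}) = ENNReal.ofReal (if b then p else 1 - p) := by
  cases b <;> simp [bern, ENNReal.ofReal_sub _ hp.le]

theorem conc {I : Type*} [Fintype I] {E : Type*} [NormedAddCommGroup E]
    [InnerProductSpace ℝ E] (p : ℝ) (hp : 0 < p) (hp1 : p ≤ 1) (x : I → E) (T D : ℝ)
    (hT : 0 < T) (hD : 0 < D) (hV : (∑ j, ‖x j‖ ^ 2) * D ≤ p * T)
    (hL : ∀ j, ‖x j‖ ^ 2 * D ^ 2 ≤ p ^ 2 * T) :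
    (Measure.pi fun _ : I => bern (ENNReal.ofReal p)).real
      {ω | T < ‖∑ j, (if ω j then 1 / p - 1 else -1 : ℝ) • x j‖ ^ 2} ≤ 2 * Real.exp (-D / 4) := by
  classical
  have := bern_prob p hp1
  set P := Measure.pi fun _ : I => bern (ENNReal.ofReal p) with hP
  set Y : (I → Bool) → E := fun ω => ∑ j, (if ω j then 1 / p - 1 else -1 : ℝ) • x j with hY
  set l := D / (2 * √T) with hl
  have hsT : 0 < √T := Real.sqrt_pos.2 hT
  have hsq : √T ^ 2 = T := Real.sq_sqrt hT.le
  have hl0 : 0 < l := by positivity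
  have hsing : ∀ ω : I → Bool, P.real {ω} = ∏ j, (if ω j then p else 1 - p) := by
    intro ω
    rw [measureReal_def, hP, Measure.pi_singleton]
    simp only [bern_sing p hp]
    rw [ENNReal.toReal_prod]
    refine Finset.prod_congr rfl fun j _ => ENNReal.toReal_ofReal ?_
    split_ifs <;> linarith
  have h1 : P.real {ω | T < ‖Y ω‖ ^ 2} ≤
      ∑ ω, P.real {ω} * (2 * Real.exp (-D / 2) * Real.cosh (l * ‖Y ω‖)) := by
    have e : {ω | T < ‖Y ω‖ ^ 2} =
      ((Finset.univ.filter fun ω => T < ‖Y ω‖ ^ 2 : Finset (I → Bool)) : Set (I → Bool)) := by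
      ext; simp
    rw [e, ← sum_measureReal_singleton, Finset.sum_filter]
    refine Finset.sum_le_sum fun ω _ => ?_
    split_ifs with h
    · have h2 : √T ≤ ‖Y ω‖ := Real.sqrt_le_iff.2 ⟨norm_nonneg _, h.le⟩
      have h3 : D / 2 ≤ l * ‖Y ω‖ := by
        calc D / 2 = l * √T := by rw [hl]; field_simp
          _ ≤ _ := by gcongr
      have h4 : Real.exp (D / 2) ≤ 2 * Real.cosh (l * ‖Y ω‖) := by
        rw [Real.cosh_eq]
        have := Real.exp_le_exp.2 h3
        have := Real.exp_pos (-(l * ‖Y ω‖))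
        linarith
      have h5 : 1 ≤ 2 * Real.exp (-D / 2) * Real.cosh (l * ‖Y ω‖) := by
        calc (1 : ℝ) = Real.exp (-D / 2) * Real.exp (D / 2) := by
              rw [← Real.exp_add, neg_div, neg_add_cancel, Real.exp_zero]
          _ ≤ Real.exp (-D / 2) * (2 * Real.cosh (l * ‖Y ω‖)) := by gcongr
          _ = _ := by ring
      exact le_mul_of_one_le_right measureReal_nonneg h5
    · have := Real.cosh_pos (l * ‖Y ω‖)
      positivity
  have h2 : ∑ ω, P.real {ω} * Real.cosh (l * ‖Y ω‖) ≤ ∏ j, (1 + ‖l • x j‖ ^ 2 / p) := by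
    have hb := pow_sum_bound (fun j => l • x j) p hp hp1 (fun j => by
      rw [norm_smul, Real.norm_of_nonneg hl0.le]
      refine (sq_le_sq₀ (by positivity) hp.le).1 ?_
      rw [mul_pow, hl, div_pow, mul_pow, hsq, div_mul_eq_mul_div, div_le_iff₀ (by positivity)]
      have := hL j
      have : 0 ≤ p ^ 2 * T := by positivity
      linarith) Finset.univ
    refine le_trans (le_of_eq ?_) hb
    refine Finset.sum_bij (fun ω _ => Finset.univ.filter fun j => ω j = true) ?_ ?_ ?_ ?_
    · simp
    · intro a _ b _ h
      funext j
      have := Finset.ext_iff.1 h j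
      simp at this
      exact this
    · intro S _
      exact ⟨fun j => decide (j ∈ S), by simp, by simp⟩
    · intro ω _
      rw [hsing]
      congr 1
      · simp
      · rw [← Real.norm_of_nonneg hl0.le, ← norm_smul, Real.norm_of_nonneg hl0.le]
        congr 2
        simp only [hY, Finset.smul_sum]
        refine Finset.sum_congr rfl fun j _ => ?_
        rw [smul_comm]; simp
  have h3 : ∏ j, (1 + ‖l • x j‖ ^ 2 / p) ≤ Real.exp (D / 4) := by
    calc ∏ j, (1 + ‖l • x j‖ ^ 2 / p) ≤ ∏ j, Real.exp (‖l • x j‖ ^ 2 / p) := by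
          refine Finset.prod_le_prod (fun _ _ => by positivity) fun j _ => ?_
          have := Real.add_one_le_exp (‖l • x j‖ ^ 2 / p)
          linarith
      _ = Real.exp (∑ j, ‖l • x j‖ ^ 2 / p) := by rw [Real.exp_sum]
      _ ≤ _ := by
        apply Real.exp_le_exp.2
        have : ∑ j, ‖l • x j‖ ^ 2 / p = l ^ 2 * (∑ j, ‖x j‖ ^ 2) / p := by
          rw [Finset.mul_sum, Finset.sum_div]
          refine Finset.sum_congr rfl fun j _ => ?_
          rw [norm_smul, mul_pow, Real.norm_eq_abs, sq_abs]
        rw [this, hl, div_pow, mul_pow, hsq, div_le_iff₀ hp, div_mul_eq_mul_div,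
          div_le_iff₀ (by positivity)]
        nlinarith
  calc _ ≤ _ := h1
    _ = 2 * Real.exp (-D / 2) * ∑ ω, P.real {ω} * Real.cosh (l * ‖Y ω‖) := by
      rw [Finset.mul_sum]; exact Finset.sum_congr rfl fun _ _ => by ring
    _ ≤ 2 * Real.exp (-D / 2) * Real.exp (D / 4) := by
      gcongr; exact h2.trans h3
    _ = _ := by
      rw [mul_assoc, ← Real.exp_add]; congr 2; ring

theorem orth_sq {n r : ℕ} (u : Fin r → Fin n → ℝ)
    (hu : ∀ i j, (∑ a, u i a * u j a) = if i = j then (1 : ℝ) else 0) (y : Fin r → ℝ) :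
    ∑ a, (∑ i, u i a * y i) ^ 2 = ∑ i, y i ^ 2 := by
  calc ∑ a, (∑ i, u i a * y i) ^ 2 = ∑ a, ∑ i, ∑ j, (u i a * u j a) * (y i * y j) := by
        refine Finset.sum_congr rfl fun a _ => ?_
        rw [sq, Finset.sum_mul_sum]
        exact Finset.sum_congr rfl fun i _ => Finset.sum_congr rfl fun j _ => by ring
    _ = ∑ i, ∑ j, (∑ a, u i a * u j a) * (y i * y j) := by
        rw [Finset.sum_comm]
        refine Finset.sum_congr rfl fun i _ => ?_
        rw [Finset.sum_comm]
        exact Finset.sum_congr rfl fun j _ => by rw [Finset.sum_mul]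
    _ = _ := by
        simp only [hu]
        refine Finset.sum_congr rfl fun i _ => ?_
        simp [sq]

theorem isBdd_swap23 {n₁ n₂ n₃ : ℕ} {A : Fin n₁ → Fin n₂ → Fin n₃ → ℝ} {B r μ : ℝ}
    (h : IsBdd n₁ n₂ n₃ A B r μ) : IsBdd n₁ n₃ n₂ (fun a c b => A a b c) B r μ := by
  obtain ⟨h1, h2, h3, h4, h5, h6, h7, h8⟩ := h
  refine ⟨fun a c b => h1 a b c, fun c b => h2 b c, fun a b => h4 a b, fun a c => h3 a c,
    h6, h5, fun a => ?_, ?_⟩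
  · rw [Finset.sum_comm, mul_comm (n₃ : ℝ)]; exact h7 a
  · have : (n₁ * n₃ * n₂ : ℝ) = n₁ * n₂ * n₃ := by ring
    rw [this]
    refine le_trans (le_of_eq ?_) h8
    congr 1
    exact Finset.sum_congr rfl fun a _ => Finset.sum_comm

theorem isBdd_swap12 {n₁ n₂ n₃ : ℕ} {A : Fin n₁ → Fin n₂ → Fin n₃ → ℝ} {B r μ : ℝ}
    (h : IsBdd n₁ n₂ n₃ A B r μ) : IsBdd n₂ n₁ n₃ (fun b a c => A a b c) B r μ := by
  obtain ⟨h1, h2, h3, h4, h5, h6, h7, h8⟩ := h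
  refine ⟨fun b a c => h1 a b c, fun a c => h3 a c, fun b c => h2 b c, fun b a => h4 a b,
    fun c => ?_, h7, h6, ?_⟩
  · rw [Finset.sum_comm, mul_comm (n₂ : ℝ)]; exact h5 c
  · rw [Finset.sum_comm, mul_comm (n₂ : ℝ)]; exact h8

theorem isBdd_combo {n₁ n₂ n₃ : ℕ} {X₁ X₂ X₃ X₄ : Fin n₁ → Fin n₂ → Fin n₃ → ℝ} {B B' r μ : ℝ}
    (hB : 28 * B' = B)
    (h1 : IsBdd n₁ n₂ n₃ X₁ B' r μ) (h2 : IsBdd n₁ n₂ n₃ X₂ B' r μ)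
    (h3 : IsBdd n₁ n₂ n₃ X₃ B' r μ) (h4 : IsBdd n₁ n₂ n₃ X₄ B' r μ) :
    IsBdd n₁ n₂ n₃ (fun a b c => X₁ a b c + X₂ a b c + X₃ a b c - 2 * X₄ a b c) B r μ := by
  subst hB
  have key : ∀ a b c, (X₁ a b c + X₂ a b c + X₃ a b c - 2 * X₄ a b c) ^ 2 ≤
      4 * X₁ a b c ^ 2 + 4 * X₂ a b c ^ 2 + 4 * X₃ a b c ^ 2 + 16 * X₄ a b c ^ 2 := by
    intro a b c
    nlinarith [sq_nonneg (X₁ a b c - X₂ a b c), sq_nonneg (X₁ a b c - X₃ a b c),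
      sq_nonneg (X₁ a b c + 2 * X₄ a b c), sq_nonneg (X₂ a b c - X₃ a b c),
      sq_nonneg (X₂ a b c + 2 * X₄ a b c), sq_nonneg (X₃ a b c + 2 * X₄ a b c)]
  obtain ⟨a1, a2, a3, a4, a5, a6, a7, a8⟩ := h1
  obtain ⟨b1, b2, b3, b4, b5, b6, b7, b8⟩ := h2
  obtain ⟨c1, c2, c3, c4, c5, c6, c7, c8⟩ := h3
  obtain ⟨d1, d2, d3, d4, d5, d6, d7, d8⟩ := h4
  refine ⟨fun a b c => ?_, fun b c => ?_, fun a c => ?_, fun a b => ?_, fun c => ?_, fun b => ?_,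
    fun a => ?_, ?_⟩
  · have := key a b c; have := a1 a b c; have := b1 a b c; have := c1 a b c; have := d1 a b c
    linarith
  · have hh := mul_le_mul_of_nonneg_left
      (Finset.sum_le_sum fun (a : Fin n₁) (_ : a ∈ Finset.univ) => key a b c)
      (by positivity : (0 : ℝ) ≤ 1 / n₁)
    simp only [Finset.sum_add_distrib, ← Finset.mul_sum] at hh
    have := a2 b c; have := b2 b c; have := c2 b c; have := d2 b c
    rw [mul_div_assoc]
    linarith
  · have hh := mul_le_mul_of_nonneg_left
      (Finset.sum_le_sum fun (b : Fin n₂) (_ : b ∈ Finset.univ) => key a b c)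
      (by positivity : (0 : ℝ) ≤ 1 / n₂)
    simp only [Finset.sum_add_distrib, ← Finset.mul_sum] at hh
    have := a3 a c; have := b3 a c; have := c3 a c; have := d3 a c
    rw [mul_div_assoc]
    linarith
  · have hh := mul_le_mul_of_nonneg_left
      (Finset.sum_le_sum fun (c : Fin n₃) (_ : c ∈ Finset.univ) => key a b c)
      (by positivity : (0 : ℝ) ≤ 1 / n₃)
    simp only [Finset.sum_add_distrib, ← Finset.mul_sum] at hh
    have := a4 a b; have := b4 a b; have := c4 a b; have := d4 a b
    rw [mul_div_assoc]
    linarith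
  · have hh := mul_le_mul_of_nonneg_left
      (Finset.sum_le_sum fun (a : Fin n₁) (_ : a ∈ Finset.univ) =>
      Finset.sum_le_sum fun (b : Fin n₂) (_ : b ∈ Finset.univ) => key a b c)
      (by positivity : (0 : ℝ) ≤ 1 / (n₁ * n₂))
    simp only [Finset.sum_add_distrib, ← Finset.mul_sum] at hh
    have := a5 c; have := b5 c; have := c5 c; have := d5 c
    rw [mul_div_assoc]
    linarith
  · have hh := mul_le_mul_of_nonneg_left
      (Finset.sum_le_sum fun (a : Fin n₁) (_ : a ∈ Finset.univ) =>
      Finset.sum_le_sum fun (c : Fin n₃) (_ : c ∈ Finset.univ) => key a b c)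
      (by positivity : (0 : ℝ) ≤ 1 / (n₁ * n₃))
    simp only [Finset.sum_add_distrib, ← Finset.mul_sum] at hh
    have := a6 b; have := b6 b; have := c6 b; have := d6 b
    rw [mul_div_assoc]
    linarith
  · have hh := mul_le_mul_of_nonneg_left
      (Finset.sum_le_sum fun (b : Fin n₂) (_ : b ∈ Finset.univ) =>
      Finset.sum_le_sum fun (c : Fin n₃) (_ : c ∈ Finset.univ) => key a b c)
      (by positivity : (0 : ℝ) ≤ 1 / (n₂ * n₃))
    simp only [Finset.sum_add_distrib, ← Finset.mul_sum] at hh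
    have := a7 a; have := b7 a; have := c7 a; have := d7 a
    rw [mul_div_assoc]
    linarith
  · have hh := mul_le_mul_of_nonneg_left
      (Finset.sum_le_sum fun (a : Fin n₁) (_ : a ∈ Finset.univ) =>
      Finset.sum_le_sum fun (b : Fin n₂) (_ : b ∈ Finset.univ) =>
      Finset.sum_le_sum fun (c : Fin n₃) (_ : c ∈ Finset.univ) => key a b c)
      (by positivity : (0 : ℝ) ≤ 1 / (n₁ * n₂ * n₃))
    simp only [Finset.sum_add_distrib, ← Finset.mul_sum] at hh
    rw [mul_div_assoc]
    linarith

theorem det_uv {n₁ n₂ n₃ r : ℕ} (h₁ : 0 < n₁) (h₂ : 0 < n₂) (h₃ : 0 < n₃) (hr : 0 < r)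
    (μ B : ℝ) (hμ : 0 < μ) (hB : 0 < B)
    (u : Fin r → Fin n₁ → ℝ) (v : Fin r → Fin n₂ → ℝ)
    (hu : ∀ i j, (∑ a, u i a * u j a) = if i = j then (1 : ℝ) else 0)
    (hv : ∀ i j, (∑ b, v i b * v j b) = if i = j then (1 : ℝ) else 0)
    (huinc : ∀ i a, (u i a) ^ 2 ≤ μ / n₁)
    (hvinc : ∀ i b, (v i b) ^ 2 ≤ μ / n₂)
    (g : Fin r → Fin n₃ → ℝ)
    (H1 : ∀ i c, g i c ^ 2 ≤ n₁ * n₂ * B / (μ ^ 2 * r))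
    (H2 : ∀ i, ∑ c, g i c ^ 2 ≤ n₁ * n₂ * n₃ * B / (μ ^ 3 * r))
    (H3 : ∀ a b, ∑ c, (∑ i, u i a * v i b * g i c) ^ 2 ≤ n₃ * B / μ) :
    IsBdd n₁ n₂ n₃ (fun a b c => ∑ i, u i a * v i b * g i c) B r μ := by
  have k₁ : (0 : ℝ) < n₁ := by exact_mod_cast h₁
  have k₂ : (0 : ℝ) < n₂ := by exact_mod_cast h₂
  have k₃ : (0 : ℝ) < n₃ := by exact_mod_cast h₃
  have kr : (0 : ℝ) < r := by exact_mod_cast hr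
  have S1 : ∀ b c, ∑ a, (∑ i, u i a * v i b * g i c) ^ 2 = ∑ i, v i b ^ 2 * g i c ^ 2 := by
    intro b c
    simp only [mul_assoc]
    rw [orth_sq u hu]
    exact Finset.sum_congr rfl fun i _ => by ring
  have S2 : ∀ a c, ∑ b, (∑ i, u i a * v i b * g i c) ^ 2 = ∑ i, u i a ^ 2 * g i c ^ 2 := by
    intro a c
    have e : ∀ b, ∑ i, u i a * v i b * g i c = ∑ i, v i b * (u i a * g i c) := fun b =>
      Finset.sum_congr rfl fun i _ => by ring
    simp only [e]
    rw [orth_sq v hv]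
    exact Finset.sum_congr rfl fun i _ => by ring
  have S12 : ∀ c, ∑ a, ∑ b, (∑ i, u i a * v i b * g i c) ^ 2 = ∑ i, g i c ^ 2 := by
    intro c
    simp only [S2]
    rw [Finset.sum_comm]
    refine Finset.sum_congr rfl fun i _ => ?_
    rw [← Finset.sum_mul]
    have := hu i i
    simp only [if_true, ← sq] at this
    rw [this, one_mul]
  have G1 : ∀ c, ∑ i, g i c ^ 2 ≤ n₁ * n₂ * B / μ ^ 2 := by
    intro c
    calc ∑ i, g i c ^ 2 ≤ ∑ i : Fin r, n₁ * n₂ * B / (μ ^ 2 * r) :=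
          Finset.sum_le_sum fun i _ => H1 i c
      _ = _ := by simp; field_simp
  have G2 : ∑ c, ∑ i, g i c ^ 2 ≤ n₁ * n₂ * n₃ * B / μ ^ 3 := by
    rw [Finset.sum_comm]
    calc ∑ i, ∑ c, g i c ^ 2 ≤ ∑ i : Fin r, n₁ * n₂ * n₃ * B / (μ ^ 3 * r) :=
          Finset.sum_le_sum fun i _ => H2 i
      _ = _ := by simp; field_simp
  have V1 : ∀ b c, ∑ i, v i b ^ 2 * g i c ^ 2 ≤ μ / n₂ * ∑ i, g i c ^ 2 := by
    intro b c
    rw [Finset.mul_sum]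
    exact Finset.sum_le_sum fun i _ => mul_le_mul_of_nonneg_right (hvinc i b) (sq_nonneg _)
  have V2 : ∀ a c, ∑ i, u i a ^ 2 * g i c ^ 2 ≤ μ / n₁ * ∑ i, g i c ^ 2 := by
    intro a c
    rw [Finset.mul_sum]
    exact Finset.sum_le_sum fun i _ => mul_le_mul_of_nonneg_right (huinc i a) (sq_nonneg _)
  refine ⟨fun a b c => ?_, fun b c => ?_, fun a c => ?_, fun a b => ?_, fun c => ?_, fun b => ?_,
    fun a => ?_, ?_⟩
  · calc (∑ i, u i a * v i b * g i c) ^ 2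
        ≤ (Finset.univ : Finset (Fin r)).card * ∑ i, (u i a * v i b * g i c) ^ 2 :=
          sq_sum_le_card_mul_sum_sq
      _ ≤ r * (μ / n₁ * (μ / n₂) * ∑ i, g i c ^ 2) := by
          rw [Finset.card_univ, Fintype.card_fin, Finset.mul_sum _ _ (μ / n₁ * (μ / n₂))]
          gcongr with i
          rw [mul_pow, mul_pow]
          gcongr
          · exact huinc i a
          · exact hvinc i b
      _ ≤ r * (μ / n₁ * (μ / n₂) * (n₁ * n₂ * B / μ ^ 2)) := by gcongr; exact G1 c
      _ = B * r := by field_simp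
  · rw [S1]
    calc _ ≤ 1 / (n₁ : ℝ) * (μ / n₂ * (n₁ * n₂ * B / μ ^ 2)) := by
          gcongr; exact (V1 b c).trans (by gcongr; exact G1 c)
      _ = _ := by field_simp
  · rw [S2]
    calc _ ≤ 1 / (n₂ : ℝ) * (μ / n₁ * (n₁ * n₂ * B / μ ^ 2)) := by
          gcongr; exact (V2 a c).trans (by gcongr; exact G1 c)
      _ = _ := by field_simp
  · calc _ ≤ 1 / (n₃ : ℝ) * (n₃ * B / μ) := by gcongr; exact H3 a b
      _ = _ := by field_simp
  · rw [S12]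
    calc _ ≤ 1 / (n₁ * n₂ : ℝ) * (n₁ * n₂ * B / μ ^ 2) := by gcongr; exact G1 c
      _ = _ := by field_simp
  · rw [Finset.sum_comm]
    simp only [S1]
    calc _ ≤ 1 / (n₁ * n₃ : ℝ) * (μ / n₂ * (n₁ * n₂ * n₃ * B / μ ^ 3)) := by
          gcongr
          refine (Finset.sum_le_sum fun c _ => V1 b c).trans ?_
          rw [← Finset.mul_sum]; gcongr
      _ = _ := by field_simp
  · rw [Finset.sum_comm]
    simp only [S2]
    calc _ ≤ 1 / (n₂ * n₃ : ℝ) * (μ / n₁ * (n₁ * n₂ * n₃ * B / μ ^ 3)) := by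
          gcongr
          refine (Finset.sum_le_sum fun c _ => V2 a c).trans ?_
          rw [← Finset.mul_sum]; gcongr
      _ = _ := by field_simp
  · have e : ∑ a, ∑ b, ∑ c, (∑ i, u i a * v i b * g i c) ^ 2 = ∑ c, ∑ i, g i c ^ 2 := by
      simp only [← S12]
      rw [Finset.sum_comm' (t' := Finset.univ) (s' := fun _ => Finset.univ) (by simp)]
      rw [Finset.sum_comm]
      rw [show (∑ x : Fin n₁, ∑ y : Fin n₂, ∑ c : Fin n₃, (∑ i, u i x * v i y * g i c) ^ 2) =
        ∑ x : Fin n₁, ∑ c : Fin n₃, ∑ y : Fin n₂, (∑ i, u i x * v i y * g i c) ^ 2 from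
        Finset.sum_congr rfl fun x _ => Finset.sum_comm]
      rw [Finset.sum_comm]
    rw [e]
    calc _ ≤ 1 / (n₁ * n₂ * n₃ : ℝ) * (n₁ * n₂ * n₃ * B / μ ^ 3) := by gcongr
      _ = _ := by field_simp

theorem det_uvw {n₁ n₂ n₃ r : ℕ} (h₁ : 0 < n₁) (h₂ : 0 < n₂) (h₃ : 0 < n₃) (hr : 0 < r)
    (μ B : ℝ) (hμ : 0 < μ) (hB : 0 < B)
    (u : Fin r → Fin n₁ → ℝ) (v : Fin r → Fin n₂ → ℝ) (w : Fin r → Fin n₃ → ℝ)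
    (hu : ∀ i j, (∑ a, u i a * u j a) = if i = j then (1 : ℝ) else 0)
    (hv : ∀ i j, (∑ b, v i b * v j b) = if i = j then (1 : ℝ) else 0)
    (hw : ∀ i j, (∑ c, w i c * w j c) = if i = j then (1 : ℝ) else 0)
    (huinc : ∀ i a, (u i a) ^ 2 ≤ μ / n₁)
    (hvinc : ∀ i b, (v i b) ^ 2 ≤ μ / n₂)
    (hwinc : ∀ i c, (w i c) ^ 2 ≤ μ / n₃)
    (h : Fin r → ℝ)
    (H : ∀ i, h i ^ 2 ≤ n₁ * n₂ * n₃ * B / (μ ^ 3 * r)) :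
    IsBdd n₁ n₂ n₃ (fun a b c => ∑ i, u i a * v i b * w i c * h i) B r μ := by
  have k₁ : (0 : ℝ) < n₁ := by exact_mod_cast h₁
  have k₂ : (0 : ℝ) < n₂ := by exact_mod_cast h₂
  have k₃ : (0 : ℝ) < n₃ := by exact_mod_cast h₃
  have kr : (0 : ℝ) < r := by exact_mod_cast hr
  simp only [mul_assoc (_ * _) (w _ _) (h _)]
  refine det_uv h₁ h₂ h₃ hr μ B hμ hB u v hu hv huinc hvinc (fun i c => w i c * h i) ?_ ?_ ?_
  · intro i c
    calc (w i c * h i) ^ 2 ≤ μ / n₃ * (n₁ * n₂ * n₃ * B / (μ ^ 3 * r)) := by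
          rw [mul_pow]; gcongr
          · exact hwinc i c
          · exact H i
      _ = _ := by field_simp
  · intro i
    simp only [mul_pow]
    rw [← Finset.sum_mul]
    have := hw i i
    simp only [if_true, ← sq] at this
    rw [this, one_mul]
    exact H i
  · intro a b
    have e : ∀ c, ∑ i, u i a * v i b * (w i c * h i) = ∑ i, w i c * (u i a * v i b * h i) :=
      fun c => Finset.sum_congr rfl fun i _ => by ring
    simp only [e]
    rw [orth_sq w hw]
    calc ∑ i, (u i a * v i b * h i) ^ 2
        ≤ ∑ i : Fin r, μ / n₁ * (μ / n₂) * (n₁ * n₂ * n₃ * B / (μ ^ 3 * r)) := by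
          refine Finset.sum_le_sum fun i _ => ?_
          rw [mul_pow, mul_pow]
          gcongr
          · exact huinc i a
          · exact hvinc i b
          · exact H i
      _ = _ := by simp; field_simp

theorem conc3 {n₁ n₂ n₃ : ℕ} {I : Type*} [Fintype I] (σ : Fin n₁ × Fin n₂ × Fin n₃ ≃ I)
    {E : Type*} [NormedAddCommGroup E]
    [InnerProductSpace ℝ E] (p : ℝ) (hp : 0 < p) (hp1 : p ≤ 1)
    (F : Fin n₁ → Fin n₂ → Fin n₃ → E) (T D : ℝ)
    (hT : 0 < T) (hD : 0 < D) (hV : (∑ a, ∑ b, ∑ c, ‖F a b c‖ ^ 2) * D ≤ p * T)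
    (hL : ∀ a b c, ‖F a b c‖ ^ 2 * D ^ 2 ≤ p ^ 2 * T) :
    (Measure.pi fun _ : I => bern (ENNReal.ofReal p)).real
      {ω | T < ‖∑ a, ∑ b, ∑ c, (if ω (σ (a, b, c)) then 1 / p - 1 else -1 : ℝ) • F a b c‖ ^ 2}
      ≤ 2 * Real.exp (-D / 4) := by
  have h := conc p hp hp1 (fun j => F (σ.symm j).1 (σ.symm j).2.1 (σ.symm j).2.2) T D hT hD (by
    rw [← σ.sum_comp]
    simpa only [Fintype.sum_prod_type, Equiv.symm_apply_apply] using hV) (fun j => hL _ _ _)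
  refine le_trans (le_of_eq ?_) h
  congr 1
  ext ω
  simp only [Set.mem_ofPred_eq]
  rw [← σ.sum_comp]
  simp only [Fintype.sum_prod_type, Equiv.symm_apply_apply]

theorem conc_s {n₁ n₂ n₃ : ℕ} {I : Type*} [Fintype I] (σ : Fin n₁ × Fin n₂ × Fin n₃ ≃ I)
    (p : ℝ) (hp : 0 < p) (hp1 : p ≤ 1)
    (A k : Fin n₁ → Fin n₂ → Fin n₃ → ℝ) (T D : ℝ)
    (hT : 0 < T) (hD : 0 < D) (hV : (∑ a, ∑ b, ∑ c, k a b c ^ 2 * A a b c ^ 2) * D ≤ p * T)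
    (hL : ∀ a b c, k a b c ^ 2 * A a b c ^ 2 * D ^ 2 ≤ p ^ 2 * T) :
    (Measure.pi fun _ : I => bern (ENNReal.ofReal p)).real
      {ω | T < (∑ a, ∑ b, ∑ c, k a b c *
        ((if ω (σ (a, b, c)) then 1 / p - 1 else -1 : ℝ) * A a b c)) ^ 2}
      ≤ 2 * Real.exp (-D / 4) := by
  have h := conc3 σ p hp hp1 (fun a b c => k a b c * A a b c) T D hT hD
    (by simpa only [Real.norm_eq_abs, sq_abs, mul_pow] using hV)
    (by simpa only [Real.norm_eq_abs, sq_abs, mul_pow] using hL)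
  refine le_trans (le_of_eq ?_) h
  simp only [Real.norm_eq_abs, sq_abs, smul_eq_mul, mul_left_comm]

theorem conc_v {n₁ n₂ n₃ : ℕ} {I : Type*} [Fintype I] (σ : Fin n₁ × Fin n₂ × Fin n₃ ≃ I)
    (p : ℝ) (hp : 0 < p) (hp1 : p ≤ 1)
    (A : Fin n₁ → Fin n₂ → Fin n₃ → ℝ) (k : Fin n₁ → Fin n₂ → ℝ) (T D : ℝ)
    (hT : 0 < T) (hD : 0 < D) (hV : (∑ a, ∑ b, k a b ^ 2 * ∑ c, A a b c ^ 2) * D ≤ p * T)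
    (hL : ∀ a b c, k a b ^ 2 * A a b c ^ 2 * D ^ 2 ≤ p ^ 2 * T) :
    (Measure.pi fun _ : I => bern (ENNReal.ofReal p)).real
      {ω | T < ∑ c, (∑ a, ∑ b, k a b *
        ((if ω (σ (a, b, c)) then 1 / p - 1 else -1 : ℝ) * A a b c)) ^ 2}
      ≤ 2 * Real.exp (-D / 4) := by
  have h := conc3 σ p hp hp1
    (fun a b c => EuclideanSpace.single c (k a b * A a b c) : _ → _ → _ → EuclideanSpace ℝ (Fin n₃))
    T D hT hD
    (by simpa only [EuclideanSpace.norm_single, Real.norm_eq_abs, sq_abs, mul_pow,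
          Finset.mul_sum] using hV)
    (by simpa only [EuclideanSpace.norm_single, Real.norm_eq_abs, sq_abs, mul_pow] using hL)
  refine le_trans (le_of_eq ?_) h
  congr 1
  ext ω
  simp only [Set.mem_ofPred_eq]
  rw [EuclideanSpace.real_norm_sq_eq]
  have e : ∀ c : Fin n₃, (∑ a, ∑ b, ∑ c, (if ω (σ (a, b, c)) then 1 / p - 1 else -1 : ℝ) •
      (EuclideanSpace.single c (k a b * A a b c) : EuclideanSpace ℝ (Fin n₃))) c =
      ∑ a, ∑ b, k a b * ((if ω (σ (a, b, c)) then 1 / p - 1 else -1 : ℝ) * A a b c) := by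
    intro c
    simp only [WithLp.ofLp_sum, Finset.sum_apply, PiLp.smul_apply, smul_eq_mul,
      EuclideanSpace.single_apply]
    refine Finset.sum_congr rfl fun a _ => Finset.sum_congr rfl fun b _ => ?_
    simp only [mul_ite, mul_zero]
    rw [Finset.sum_ite_eq]
    simp only [Finset.mem_univ, if_true]
    ring
  simp only [e]

theorem sq_sum_orth2 {n₁ n₂ r : ℕ} (u : Fin r → Fin n₁ → ℝ) (v : Fin r → Fin n₂ → ℝ)
    (hu : ∀ i j, (∑ a, u i a * u j a) = if i = j then (1 : ℝ) else 0)
    (hv : ∀ i j, (∑ b, v i b * v j b) = if i = j then (1 : ℝ) else 0) (y : Fin r → ℝ) :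
    ∑ a, ∑ b, (∑ i, y i * (u i a * v i b)) ^ 2 = ∑ i, y i ^ 2 := by
  have e : ∀ a b, ∑ i, y i * (u i a * v i b) = ∑ i, v i b * (u i a * y i) := fun a b =>
    Finset.sum_congr rfl fun i _ => by ring
  simp only [e, orth_sq v hv]
  rw [Finset.sum_comm]
  refine Finset.sum_congr rfl fun i _ => ?_
  have := hu i i
  simp only [if_true, ← sq] at this
  simp only [mul_pow]
  rw [← Finset.sum_mul, this, one_mul]

theorem prob_uv {n₁ n₂ n₃ r : ℕ} (h₁ : 0 < n₁) (h₂ : 0 < n₂) (h₃ : 0 < n₃) (hr : 0 < r)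
    {I : Type*} [Fintype I] (σ : Fin n₁ × Fin n₂ × Fin n₃ ≃ I)
    (μ B C D m p : ℝ) (hμ : 1 ≤ μ) (hB : 0 < B) (hC : 1 ≤ C) (hD : 0 < D)
    (hp : p = m / (n₁ * n₂ * n₃)) (hm0 : 0 < m) (hp1 : p ≤ 1)
    (hrμ : μ * r ≤ n₃) (hm : 28 * C * D * r * μ ^ 2 * n₃ ≤ m)
    (u : Fin r → Fin n₁ → ℝ) (v : Fin r → Fin n₂ → ℝ)
    (hu : ∀ i j, (∑ a, u i a * u j a) = if i = j then (1 : ℝ) else 0)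
    (hv : ∀ i j, (∑ b, v i b * v j b) = if i = j then (1 : ℝ) else 0)
    (huinc : ∀ i a, (u i a) ^ 2 ≤ μ / n₁)
    (hvinc : ∀ i b, (v i b) ^ 2 ≤ μ / n₂)
    (A : Fin n₁ → Fin n₂ → Fin n₃ → ℝ) (hA : IsBdd n₁ n₂ n₃ A B r μ) :
    (Measure.pi fun _ : I => bern (ENNReal.ofReal p)).real
      {ω | ¬ IsBdd n₁ n₂ n₃ (fun a b c => ∑ i, u i a * v i b * (∑ a', ∑ b', u i a' * v i b' *
        ((if ω (σ (a', b', c)) then 1 / p - 1 else -1 : ℝ) * A a' b' c))) (B / (28 * C)) r μ}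
      ≤ (r * n₃ + r + n₁ * n₂) * (2 * Real.exp (-D / 4)) := by
  have k₁ : (0 : ℝ) < n₁ := by exact_mod_cast h₁
  have k₂ : (0 : ℝ) < n₂ := by exact_mod_cast h₂
  have k₃ : (0 : ℝ) < n₃ := by exact_mod_cast h₃
  have kr : (0 : ℝ) < r := by exact_mod_cast hr
  have kr1 : (1 : ℝ) ≤ r := by exact_mod_cast hr
  have kμ : 0 < μ := by linarith
  have kC : 0 < C := by linarith
  have hp0 : 0 < p := by rw [hp]; positivity
  have hμn : μ ≤ n₃ := by nlinarith
  have := bern_prob p hp1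
  have Q : 28 * C * (D * r * μ ^ 2 * n₃) ^ 2 ≤ m ^ 2 := by
    have hq : 0 ≤ D * r * μ ^ 2 * n₃ := by positivity
    have : (28 * C * D * r * μ ^ 2 * n₃) ^ 2 ≤ m ^ 2 := by gcongr
    refine le_trans ?_ this
    have e : (28 * C * D * r * μ ^ 2 * n₃) ^ 2 =
      28 * C * (28 * C * (D * r * μ ^ 2 * n₃) ^ 2) := by ring
    rw [e]
    refine le_mul_of_one_le_left (by positivity) (by linarith)
  obtain ⟨a1, -, -, a4, a5, -, -, a8⟩ := hA
  have A4 : ∀ a b, ∑ c, A a b c ^ 2 ≤ n₃ * B / μ := by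
    intro a b
    have := mul_le_mul_of_nonneg_left (a4 a b) k₃.le
    calc _ = n₃ * (1 / (n₃ : ℝ) * (∑ c, (A a b c) ^ 2)) := by field_simp
      _ ≤ _ := this
      _ = _ := by ring
  have A5 : ∀ c, ∑ a, ∑ b, A a b c ^ 2 ≤ n₁ * n₂ * B / μ ^ 2 := by
    intro c
    have := mul_le_mul_of_nonneg_left (a5 c) (by positivity : (0 : ℝ) ≤ n₁ * n₂)
    calc _ = n₁ * n₂ * (1 / (n₁ * n₂ : ℝ) * (∑ a, ∑ b, (A a b c) ^ 2)) := by field_simp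
      _ ≤ _ := this
      _ = _ := by ring
  have A8 : ∑ a, ∑ b, ∑ c, A a b c ^ 2 ≤ n₁ * n₂ * n₃ * B / μ ^ 3 := by
    have := mul_le_mul_of_nonneg_left a8 (by positivity : (0 : ℝ) ≤ n₁ * n₂ * n₃)
    calc _ = n₁ * n₂ * n₃ * (1 / (n₁ * n₂ * n₃ : ℝ) * (∑ a, ∑ b, ∑ c, (A a b c) ^ 2)) := by
          field_simp
      _ ≤ _ := this
      _ = _ := by ring
  have UV : ∀ i a b, (u i a * v i b) ^ 2 ≤ μ / n₁ * (μ / n₂) := by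
    intro i a b
    rw [mul_pow]
    gcongr
    · exact huinc i a
    · exact hvinc i b
  set B' := B / (28 * C) with hB'
  have kB' : 0 < B' := by positivity
  set P := Measure.pi fun _ : I => bern (ENNReal.ofReal p)
  set T1 : ℝ := n₁ * n₂ * B' / (μ ^ 2 * r) with hT1
  set T2 : ℝ := n₁ * n₂ * n₃ * B' / (μ ^ 3 * r) with hT2
  set T3 : ℝ := n₃ * B' / μ with hT3
  set g : (I → Bool) → Fin r → Fin n₃ → ℝ := fun ω i c => ∑ a', ∑ b', u i a' * v i b' *
        ((if ω (σ (a', b', c)) then 1 / p - 1 else -1 : ℝ) * A a' b' c) with hg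
  have E1 : ∀ i c, P.real {ω | T1 < g ω i c ^ 2} ≤ 2 * Real.exp (-D / 4) := by
    intro i c
    have h := conc_s σ p hp0 hp1 A (fun a b c' => if c' = c then u i a * v i b else 0) T1 D
      (by positivity) hD ?_ ?_
    · refine le_trans (le_of_eq ?_) h
      congr 1
      ext ω
      simp only [hg, Set.mem_ofPred_eq, ite_mul, zero_mul, Finset.sum_ite_eq', Finset.mem_univ,
        if_true]
    · simp only [ite_pow, ite_mul, zero_mul, ne_eq, OfNat.ofNat_ne_zero, not_false_eq_true,
        zero_pow, Finset.sum_ite_eq', Finset.mem_univ, if_true]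
      calc _ ≤ (μ / n₁ * (μ / n₂) * (n₁ * n₂ * B / μ ^ 2)) * D := by
            gcongr
            refine le_trans ?_ (mul_le_mul_of_nonneg_left (A5 c) (by positivity))
            simp only [Finset.mul_sum]
            gcongr with a _ b
            exact UV i a b
        _ = B * D * (28 * C * D * r * μ ^ 2 * n₃) / (28 * C * D * r * μ ^ 2 * n₃) := by
            field_simp
        _ ≤ B * D * m / (28 * C * D * r * μ ^ 2 * n₃) := by gcongr
        _ = _ := by rw [hp, hT1, hB']; field_simp
    · intro a b c'
      calc _ ≤ μ / n₁ * (μ / n₂) * (B * r) * D ^ 2 := by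
            gcongr
            · split_ifs
              · exact UV i a b
              · simp; positivity
            · exact a1 a b c'
        _ = B * (28 * C * (D * r * μ ^ 2 * n₃) ^ 2) / (28 * C * n₁ * n₂ * n₃ ^ 2 * μ ^ 2 * r) := by
            field_simp
        _ ≤ B * m ^ 2 / (28 * C * n₁ * n₂ * n₃ ^ 2 * μ ^ 2 * r) := by gcongr
        _ = _ := by rw [hp, hT1, hB']; field_simp
  have E2 : ∀ i, P.real {ω | T2 < ∑ c, g ω i c ^ 2} ≤ 2 * Real.exp (-D / 4) := by
    intro i
    refine conc_v σ p hp0 hp1 A (fun a b => u i a * v i b) T2 D (by positivity) hD ?_ ?_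
    · calc _ ≤ (μ / n₁ * (μ / n₂) * (n₁ * n₂ * n₃ * B / μ ^ 3)) * D := by
            gcongr
            refine le_trans ?_ (mul_le_mul_of_nonneg_left A8 (by positivity))
            rw [Finset.mul_sum]
            refine Finset.sum_le_sum fun a _ => ?_
            rw [Finset.mul_sum]
            gcongr with b
            exact UV i a b
        _ = B * (28 * C * D * r * μ ^ 2 * n₃) / (28 * C * r * μ ^ 3) := by
            field_simp
        _ ≤ B * m / (28 * C * r * μ ^ 3) := by gcongr
        _ = _ := by rw [hp, hT2, hB']; field_simp
    · intro a b c
      calc _ ≤ μ / n₁ * (μ / n₂) * (B * r) * D ^ 2 := by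
            gcongr
            · exact UV i a b
            · exact a1 a b c
        _ = B * (28 * C * (D * r * μ ^ 2) ^ 2 * n₃ * μ) / (28 * C * n₁ * n₂ * n₃ * μ ^ 3 * r) := by
            field_simp
        _ ≤ B * (28 * C * (D * r * μ ^ 2) ^ 2 * n₃ * n₃) / (28 * C * n₁ * n₂ * n₃ * μ ^ 3 * r) := by
            gcongr
        _ = B * (28 * C * (D * r * μ ^ 2 * n₃) ^ 2) / (28 * C * n₁ * n₂ * n₃ * μ ^ 3 * r) := by
            ring
        _ ≤ B * m ^ 2 / (28 * C * n₁ * n₂ * n₃ * μ ^ 3 * r) := by gcongr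
        _ = _ := by rw [hp, hT2, hB']; field_simp
  have E3 : ∀ a b, P.real {ω | T3 < ∑ c, (∑ i, u i a * v i b * g ω i c) ^ 2} ≤
      2 * Real.exp (-D / 4) := by
    intro a b
    have K1 : ∑ a', ∑ b', (∑ i, (u i a * v i b) * (u i a' * v i b')) ^ 2 ≤
        r * (μ / n₁ * (μ / n₂)) := by
      rw [sq_sum_orth2 u v hu hv]
      calc _ ≤ ∑ i : Fin r, μ / n₁ * (μ / n₂) := Finset.sum_le_sum fun i _ => UV i a b
        _ = _ := by simp
    have K2 : ∀ a' b', (∑ i, (u i a * v i b) * (u i a' * v i b')) ^ 2 ≤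
        r * (r * ((μ / n₁ * (μ / n₂)) * (μ / n₁ * (μ / n₂)))) := by
      intro a' b'
      calc _ ≤ ((Finset.univ : Finset (Fin r)).card : ℝ) *
              ∑ i, ((u i a * v i b) * (u i a' * v i b')) ^ 2 := sq_sum_le_card_mul_sum_sq
        _ ≤ r * ∑ i : Fin r, ((μ / n₁ * (μ / n₂)) * (μ / n₁ * (μ / n₂))) := by
            rw [Finset.card_univ, Fintype.card_fin]
            gcongr with i
            rw [mul_pow]
            gcongr
            · exact UV i a b
            · exact UV i a' b'
        _ = _ := by simp
    have h := conc_v σ p hp0 hp1 A (fun a' b' => ∑ i, (u i a * v i b) * (u i a' * v i b')) T3 D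
      (by positivity) hD ?_ ?_
    · refine le_trans (le_of_eq ?_) h
      congr 1
      ext ω
      simp only [Set.mem_ofPred_eq]
      have e : ∀ c, ∑ i, u i a * v i b * g ω i c = ∑ a', ∑ b',
          (∑ i, (u i a * v i b) * (u i a' * v i b')) *
          ((if ω (σ (a', b', c)) then 1 / p - 1 else -1 : ℝ) * A a' b' c) := by
        intro c
        simp only [hg, Finset.mul_sum, Finset.sum_mul]
        rw [Finset.sum_comm]
        refine Finset.sum_congr rfl fun a' _ => ?_
        rw [Finset.sum_comm]
        exact Finset.sum_congr rfl fun b' _ => Finset.sum_congr rfl fun i _ => by ring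
      simp only [e]
    · calc _ ≤ (r * (μ / n₁ * (μ / n₂)) * (n₃ * B / μ)) * D := by
            gcongr
            refine le_trans ?_ (mul_le_mul_of_nonneg_right K1 (by positivity))
            simp only [Finset.sum_mul]
            gcongr with a' _ b'
            exact A4 a' b'
        _ = B * (28 * C * D * r * μ ^ 2 * n₃) / (28 * C * μ * n₁ * n₂) := by
            field_simp
        _ ≤ B * m / (28 * C * μ * n₁ * n₂) := by gcongr
        _ = _ := by rw [hp, hT3, hB']; field_simp
    · intro a' b' c
      calc _ ≤ r * (r * ((μ / n₁ * (μ / n₂)) * (μ / n₁ * (μ / n₂)))) * (B * r) * D ^ 2 := by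
            gcongr
            · exact K2 a' b'
            · exact a1 a' b' c
        _ = B * (28 * C * (D * r * μ ^ 2) ^ 2 * n₃ * (μ * r)) /
              (28 * C * n₁ ^ 2 * n₂ ^ 2 * n₃ * μ) := by
            field_simp
        _ ≤ B * (28 * C * (D * r * μ ^ 2) ^ 2 * n₃ * n₃) /
              (28 * C * n₁ ^ 2 * n₂ ^ 2 * n₃ * μ) := by
            gcongr
        _ = B * (28 * C * (D * r * μ ^ 2 * n₃) ^ 2) / (28 * C * n₁ ^ 2 * n₂ ^ 2 * n₃ * μ) := by
            ring
        _ ≤ B * m ^ 2 / (28 * C * n₁ ^ 2 * n₂ ^ 2 * n₃ * μ) := by gcongr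
        _ = _ := by rw [hp, hT3, hB']; field_simp
  have hsub : {ω | ¬ IsBdd n₁ n₂ n₃ (fun a b c => ∑ i, u i a * v i b * g ω i c) B' r μ} ⊆
      ((⋃ i, ⋃ c, {ω | T1 < g ω i c ^ 2}) ∪ (⋃ i, {ω | T2 < ∑ c, g ω i c ^ 2})) ∪
      (⋃ a, ⋃ b, {ω | T3 < ∑ c, (∑ i, u i a * v i b * g ω i c) ^ 2}) := by
    intro ω hω
    by_contra hcon
    simp only [Set.mem_union, Set.mem_iUnion, Set.mem_ofPred_eq, not_or, not_exists, not_lt] at hcon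
    exact hω (det_uv h₁ h₂ h₃ hr μ B' kμ kB' u v hu hv huinc hvinc (g ω) hcon.1.1 hcon.1.2 hcon.2)
  refine (measureReal_mono hsub).trans ?_
  refine (measureReal_union_le _ _).trans ?_
  set e := 2 * Real.exp (-D / 4)
  have f1 : P.real (⋃ i, ⋃ c, {ω | T1 < g ω i c ^ 2}) ≤ r * n₃ * e := by
    calc _ ≤ ∑ i : Fin r, ∑ c : Fin n₃, e :=
          (measureReal_iUnion_fintype_le _).trans (Finset.sum_le_sum fun i _ =>
            (measureReal_iUnion_fintype_le _).trans (Finset.sum_le_sum fun c _ => E1 i c))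
      _ = _ := by simp [mul_assoc]
  have f2 : P.real (⋃ i, {ω | T2 < ∑ c, g ω i c ^ 2}) ≤ r * e := by
    calc _ ≤ ∑ i : Fin r, e :=
          (measureReal_iUnion_fintype_le _).trans (Finset.sum_le_sum fun i _ => E2 i)
      _ = _ := by simp
  have f3 : P.real (⋃ a, ⋃ b, {ω | T3 < ∑ c, (∑ i, u i a * v i b * g ω i c) ^ 2}) ≤
      n₁ * n₂ * e := by
    calc _ ≤ ∑ a : Fin n₁, ∑ b : Fin n₂, e :=
          (measureReal_iUnion_fintype_le _).trans (Finset.sum_le_sum fun i _ =>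
            (measureReal_iUnion_fintype_le _).trans (Finset.sum_le_sum fun c _ => E3 i c))
      _ = _ := by simp [mul_assoc]
  have := measureReal_union_le (μ := P) (⋃ i, ⋃ c, {ω | T1 < g ω i c ^ 2})
    (⋃ i, {ω | T2 < ∑ c, g ω i c ^ 2})
  linarith

theorem prob_uvw {n₁ n₂ n₃ r : ℕ} (h₁ : 0 < n₁) (h₂ : 0 < n₂) (h₃ : 0 < n₃) (hr : 0 < r)
    (μ B C D m p : ℝ) (hμ : 1 ≤ μ) (hB : 0 < B) (hC : 1 ≤ C) (hD : 0 < D)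
    (hp : p = m / (n₁ * n₂ * n₃)) (hm0 : 0 < m) (hp1 : p ≤ 1)
    (hm : 28 * C * D * r * μ ^ 3 ≤ m)
    (u : Fin r → Fin n₁ → ℝ) (v : Fin r → Fin n₂ → ℝ) (w : Fin r → Fin n₃ → ℝ)
    (hu : ∀ i j, (∑ a, u i a * u j a) = if i = j then (1 : ℝ) else 0)
    (hv : ∀ i j, (∑ b, v i b * v j b) = if i = j then (1 : ℝ) else 0)
    (hw : ∀ i j, (∑ c, w i c * w j c) = if i = j then (1 : ℝ) else 0)
    (huinc : ∀ i a, (u i a) ^ 2 ≤ μ / n₁)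
    (hvinc : ∀ i b, (v i b) ^ 2 ≤ μ / n₂)
    (hwinc : ∀ i c, (w i c) ^ 2 ≤ μ / n₃)
    (A : Fin n₁ → Fin n₂ → Fin n₃ → ℝ) (hA : IsBdd n₁ n₂ n₃ A B r μ) :
    (Measure.pi fun _ : Fin n₁ × Fin n₂ × Fin n₃ => bern (ENNReal.ofReal p)).real
      {ω | ¬ IsBdd n₁ n₂ n₃ (fun a b c => ∑ i, u i a * v i b * w i c *
        (∑ a', ∑ b', ∑ c', u i a' * v i b' * w i c' *
        ((if ω (a', b', c') then 1 / p - 1 else -1 : ℝ) * A a' b' c'))) (B / (28 * C)) r μ}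
      ≤ r * (2 * Real.exp (-D / 4)) := by
  have k₁ : (0 : ℝ) < n₁ := by exact_mod_cast h₁
  have k₂ : (0 : ℝ) < n₂ := by exact_mod_cast h₂
  have k₃ : (0 : ℝ) < n₃ := by exact_mod_cast h₃
  have kr : (0 : ℝ) < r := by exact_mod_cast hr
  have kμ : 0 < μ := by linarith
  have kC : 0 < C := by linarith
  have hp0 : 0 < p := by rw [hp]; positivity
  have := bern_prob p hp1
  have Q : 28 * C * (D * r * μ ^ 3) ^ 2 ≤ m ^ 2 := by
    have : (28 * C * D * r * μ ^ 3) ^ 2 ≤ m ^ 2 := by gcongr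
    refine le_trans ?_ this
    have e : (28 * C * D * r * μ ^ 3) ^ 2 =
      28 * C * (28 * C * (D * r * μ ^ 3) ^ 2) := by ring
    rw [e]
    refine le_mul_of_one_le_left (by positivity) (by linarith)
  obtain ⟨a1, -, -, -, -, -, -, a8⟩ := hA
  have A8 : ∑ a, ∑ b, ∑ c, A a b c ^ 2 ≤ n₁ * n₂ * n₃ * B / μ ^ 3 := by
    have := mul_le_mul_of_nonneg_left a8 (by positivity : (0 : ℝ) ≤ n₁ * n₂ * n₃)
    calc _ = n₁ * n₂ * n₃ * (1 / (n₁ * n₂ * n₃ : ℝ) * (∑ a, ∑ b, ∑ c, (A a b c) ^ 2)) := by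
          field_simp
      _ ≤ _ := this
      _ = _ := by ring
  have UV : ∀ i a b c, (u i a * v i b * w i c) ^ 2 ≤ μ / n₁ * (μ / n₂) * (μ / n₃) := by
    intro i a b c
    rw [mul_pow, mul_pow]
    gcongr
    · exact huinc i a
    · exact hvinc i b
    · exact hwinc i c
  set B' := B / (28 * C) with hB'
  have kB' : 0 < B' := by positivity
  set P := Measure.pi fun _ : Fin n₁ × Fin n₂ × Fin n₃ => bern (ENNReal.ofReal p)
  set T : ℝ := n₁ * n₂ * n₃ * B' / (μ ^ 3 * r) with hT
  set h : (Fin n₁ × Fin n₂ × Fin n₃ → Bool) → Fin r → ℝ := fun ω i =>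
    ∑ a', ∑ b', ∑ c', u i a' * v i b' * w i c' *
        ((if ω (a', b', c') then 1 / p - 1 else -1 : ℝ) * A a' b' c') with hh
  have E1 : ∀ i, P.real {ω | T < h ω i ^ 2} ≤ 2 * Real.exp (-D / 4) := by
    intro i
    refine conc_s (Equiv.refl _) p hp0 hp1 A (fun a b c => u i a * v i b * w i c) T D
      (by positivity) hD ?_ ?_
    · calc _ ≤ (μ / n₁ * (μ / n₂) * (μ / n₃) * (n₁ * n₂ * n₃ * B / μ ^ 3)) * D := by
            gcongr
            refine le_trans ?_ (mul_le_mul_of_nonneg_left A8 (by positivity))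
            simp only [Finset.mul_sum]
            gcongr with a _ b _ c
            exact UV i a b c
        _ = B * (28 * C * D * r * μ ^ 3) / (28 * C * r * μ ^ 3) := by
            field_simp
        _ ≤ B * m / (28 * C * r * μ ^ 3) := by gcongr
        _ = _ := by rw [hp, hT, hB']; field_simp
    · intro a b c
      calc _ ≤ μ / n₁ * (μ / n₂) * (μ / n₃) * (B * r) * D ^ 2 := by
            gcongr
            · exact UV i a b c
            · exact a1 a b c
        _ = B * (28 * C * (D * r * μ ^ 3) ^ 2) / (28 * C * n₁ * n₂ * n₃ * μ ^ 3 * r) := by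
            field_simp
        _ ≤ B * m ^ 2 / (28 * C * n₁ * n₂ * n₃ * μ ^ 3 * r) := by gcongr
        _ = _ := by rw [hp, hT, hB']; field_simp
  have hsub : {ω | ¬ IsBdd n₁ n₂ n₃ (fun a b c => ∑ i, u i a * v i b * w i c * h ω i) B' r μ} ⊆
      ⋃ i, {ω | T < h ω i ^ 2} := by
    intro ω hω
    by_contra hcon
    simp only [Set.mem_iUnion, Set.mem_ofPred_eq, not_exists, not_lt] at hcon
    exact hω (det_uvw h₁ h₂ h₃ hr μ B' kμ kB' u v w hu hv hw huinc hvinc hwinc (h ω) hcon)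
  refine (measureReal_mono hsub).trans ?_
  calc _ ≤ ∑ i : Fin r, 2 * Real.exp (-D / 4) :=
          (measureReal_iUnion_fintype_le _).trans (Finset.sum_le_sum fun i _ => E1 i)
    _ = _ := by simp

theorem union4 {X : Type*} [MeasurableSpace X] (P : Measure X) [IsFiniteMeasure P]
    {q1 q2 q3 q4 q : X → Prop} {b1 b2 b3 b4 : ℝ} (R1 : P.real {ω | ¬ q1 ω} ≤ b1)
    (R2 : P.real {ω | ¬ q2 ω} ≤ b2) (R3 : P.real {ω | ¬ q3 ω} ≤ b3)
    (R4 : P.real {ω | ¬ q4 ω} ≤ b4) (h : ∀ ω, q1 ω → q2 ω → q3 ω → q4 ω → q ω) :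
    P.real {ω | ¬ q ω} ≤ b1 + b2 + b3 + b4 := by
  have hsub : {ω | ¬ q ω} ⊆
      (({ω | ¬ q1 ω} ∪ {ω | ¬ q2 ω}) ∪ {ω | ¬ q3 ω}) ∪ {ω | ¬ q4 ω} := by
    intro ω hω
    by_contra hc
    simp only [Set.mem_union, Set.mem_ofPred_eq, not_or, not_not] at hc
    exact hω (h ω hc.1.1.1 hc.1.1.2 hc.1.2 hc.2)
  have e1 := measureReal_mono (μ := P) hsub
  have e2 := measureReal_union_le (μ := P)
    (({ω | ¬ q1 ω} ∪ {ω | ¬ q2 ω}) ∪ {ω | ¬ q3 ω}) {ω | ¬ q4 ω}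
  have e3 := measureReal_union_le (μ := P) ({ω | ¬ q1 ω} ∪ {ω | ¬ q2 ω}) {ω | ¬ q3 ω}
  have e4 := measureReal_union_le (μ := P) {ω | ¬ q1 ω} {ω | ¬ q2 ω}
  linarith

set_option maxHeartbeats 2000000 in
theorem stmt_19 (n₁ n₂ n₃ : ℕ) (h₁ : 2 ≤ n₁) (h₂ : 2 ≤ n₂) (h₃ : 2 ≤ n₃)
    (r : ℕ) (hr : 1 ≤ r) (μ B C β m : ℝ)
    (hμ : 1 ≤ μ) (hB : 0 < B) (hC : 1 ≤ C) (hβ : 0 < β)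
    (hrμ : μ * r ≤ ((min (min n₁ n₂) n₃ : ℕ) : ℝ))
    (hm1 : 10000 * C * (2 + β) ^ 2 * ((max (max n₁ n₂) n₃ : ℕ) : ℝ) * r * μ ^ 2 *
        Real.log ((max (max n₁ n₂) n₃ : ℕ) : ℝ) < m)
    (hm2 : 10000 * C * (2 + β) ^ 2 * r * Real.sqrt n₁ * ((max n₂ n₃ : ℕ) : ℝ) *
        μ ^ ((3 : ℝ) / 2) * Real.log ((max (max n₁ n₂) n₃ : ℕ) : ℝ) < m)
    (hm3 : m ≤ (n₁ * n₂ * n₃ : ℝ))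
    (u : Fin r → Fin n₁ → ℝ) (v : Fin r → Fin n₂ → ℝ) (w : Fin r → Fin n₃ → ℝ)
    (hu : ∀ i j, (∑ a, u i a * u j a) = if i = j then (1 : ℝ) else 0)
    (hv : ∀ i j, (∑ b, v i b * v j b) = if i = j then (1 : ℝ) else 0)
    (hw : ∀ i j, (∑ c, w i c * w j c) = if i = j then (1 : ℝ) else 0)
    (huinc : ∀ i a, (u i a) ^ 2 ≤ μ / n₁)
    (hvinc : ∀ i b, (v i b) ^ 2 ≤ μ / n₂)
    (hwinc : ∀ i c, (w i c) ^ 2 ≤ μ / n₃)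
    (A : Fin n₁ → Fin n₂ → Fin n₃ → ℝ) (hA : IsBdd n₁ n₂ n₃ A B r μ) :
    (Measure.pi fun _ : Fin n₁ × Fin n₂ × Fin n₃ =>
        bern (ENNReal.ofReal (m / (n₁ * n₂ * n₃))))
      {ω : Fin n₁ × Fin n₂ × Fin n₃ → Bool |
        ¬ IsBdd n₁ n₂ n₃
            -- P (R̄_Ω A) = (P_UV + P_UW + P_VW − 2 P_UVW)(R̄_Ω A)
            (fun a b c =>
              (∑ i : Fin r, u i a * v i b *
                (∑ a', ∑ b', u i a' * v i b' *
                  ((if ω (a', b', c) then (n₁ * n₂ * n₃ : ℝ) / m - 1 else -1) *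
                    A a' b' c))) +
              (∑ i : Fin r, u i a * w i c *
                (∑ a', ∑ c', u i a' * w i c' *
                  ((if ω (a', b, c') then (n₁ * n₂ * n₃ : ℝ) / m - 1 else -1) *
                    A a' b c'))) +
              (∑ i : Fin r, v i b * w i c *
                (∑ b', ∑ c', v i b' * w i c' *
                  ((if ω (a, b', c') then (n₁ * n₂ * n₃ : ℝ) / m - 1 else -1) *
                    A a b' c'))) -
              2 * (∑ i : Fin r, u i a * v i b * w i c *
                (∑ a', ∑ b', ∑ c', u i a' * v i b' * w i c' *
                  ((if ω (a', b', c') then (n₁ * n₂ * n₃ : ℝ) / m - 1 else -1) *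
                    A a' b' c'))))
            (B / C) r μ}
      < ENNReal.ofReal (100 * ((max (max n₁ n₂) n₃ : ℕ) : ℝ) ^ (-(β + 1))) := by
  classical
  set n : ℕ := max (max n₁ n₂) n₃ with hn
  have hn1 : n₁ ≤ n := by omega
  have hn2 : n₂ ≤ n := by omega
  have hn3 : n₃ ≤ n := by omega
  have hm1' : μ * r ≤ n₁ := hrμ.trans (by exact_mod_cast (by omega))
  have hm2' : μ * r ≤ n₂ := hrμ.trans (by exact_mod_cast (by omega))
  have hm3' : μ * r ≤ n₃ := hrμ.trans (by exact_mod_cast (by omega))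
  have k₁ : (0 : ℝ) < n₁ := by exact_mod_cast (by omega)
  have k₂ : (0 : ℝ) < n₂ := by exact_mod_cast (by omega)
  have k₃ : (0 : ℝ) < n₃ := by exact_mod_cast (by omega)
  have q₁ : (n₁ : ℝ) ≤ n := by exact_mod_cast hn1
  have q₂ : (n₂ : ℝ) ≤ n := by exact_mod_cast hn2
  have q₃ : (n₃ : ℝ) ≤ n := by exact_mod_cast hn3
  have kr1 : (1 : ℝ) ≤ r := by exact_mod_cast hr
  have kr : (0 : ℝ) < r := by linarith
  have kμ : 0 < μ := by linarith
  have kC : 0 < C := by linarith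
  have kn : (2 : ℝ) ≤ n := by exact_mod_cast (by omega)
  have kn0 : (0 : ℝ) < n := by linarith
  have hl : 0 < Real.log n := Real.log_pos (by linarith)
  have hrn₁ : (r : ℝ) ≤ n₁ := by nlinarith
  have hrn₂ : (r : ℝ) ≤ n₂ := by nlinarith
  have hrn₃ : (r : ℝ) ≤ n₃ := by nlinarith
  have hμn : μ ≤ n₃ := by nlinarith
  set D : ℝ := 4 * (3 + β) * Real.log n with hD
  have hD0 : 0 < D := by positivity
  have hM : 28 * C * D * r * μ ^ 2 * n ≤ m := by
    refine le_trans ?_ hm1.le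
    have : 28 * (4 * (3 + β)) ≤ 10000 * (2 + β) ^ 2 := by nlinarith
    calc 28 * C * D * r * μ ^ 2 * n =
        (28 * (4 * (3 + β))) * (C * Real.log n * r * μ ^ 2 * n) := by rw [hD]; ring
      _ ≤ (10000 * (2 + β) ^ 2) * (C * Real.log n * r * μ ^ 2 * n) := by gcongr
      _ = _ := by ring
  have hm0 : 0 < m := lt_of_lt_of_le (by positivity) hM
  have hM' : ∀ x : ℝ, x ≤ n → 28 * C * D * r * μ ^ 2 * x ≤ m := fun x hx =>
    le_trans (by gcongr) hM
  set p : ℝ := m / (n₁ * n₂ * n₃) with hp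
  have hp1 : p ≤ 1 := by rw [hp, div_le_one (by positivity)]; exact hm3
  have hpe : (n₁ * n₂ * n₃ : ℝ) / m = 1 / p := by rw [hp, one_div_div]
  simp only [hpe]
  have := bern_prob p hp1
  set P := Measure.pi fun _ : Fin n₁ × Fin n₂ × Fin n₃ => bern (ENNReal.ofReal p) with hPdef
  have R1 := prob_uv (by omega) (by omega) (by omega) hr
    (Equiv.refl (Fin n₁ × Fin n₂ × Fin n₃)) μ B C D m p hμ hB hC hD0 hp hm0 hp1 hm3' (hM' _ q₃)
    u v hu hv huinc hvinc A hA
  let σ₂ : Fin n₁ × Fin n₃ × Fin n₂ ≃ Fin n₁ × Fin n₂ × Fin n₃ :=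
    ⟨fun x => (x.1, x.2.2, x.2.1), fun x => (x.1, x.2.2, x.2.1), fun _ => rfl, fun _ => rfl⟩
  let σ₃ : Fin n₂ × Fin n₃ × Fin n₁ ≃ Fin n₁ × Fin n₂ × Fin n₃ :=
    ⟨fun x => (x.2.2, x.1, x.2.1), fun x => (x.2.1, x.2.2, x.1), fun _ => rfl, fun _ => rfl⟩
  have R2 := prob_uv (by omega) (by omega) (by omega) hr
    σ₂ μ B C D m p hμ hB hC hD0 (by rw [hp]; congr 1; ring) hm0 hp1 hm2' (hM' _ q₂)
    u w hu hw huinc hwinc _ (isBdd_swap23 hA)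
  have R3 := prob_uv (by omega) (by omega) (by omega) hr
    σ₃ μ B C D m p hμ hB hC hD0 (by rw [hp]; congr 1; ring) hm0 hp1 hm1' (hM' _ q₁)
    v w hv hw hvinc hwinc _ (isBdd_swap23 (isBdd_swap12 hA))
  have R4 := prob_uvw (by omega) (by omega) (by omega) hr
    μ B C D m p hμ hB hC hD0 hp hm0 hp1
    (le_trans (le_of_eq (by ring)) (hM' μ (hμn.trans q₃)))
    u v w hu hv hw huinc hvinc hwinc A hA
  rw [← ofReal_measureReal]
  refine (ENNReal.ofReal_lt_ofReal_iff (by positivity)).2 ?_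
  rw [← hPdef] at R1 R2 R3 R4
  refine lt_of_le_of_lt (union4 P R1 R2 R3 R4 fun ω c1 c2 c3 c4 =>
    isBdd_combo (by field_simp) c1 (isBdd_swap23 c2) (isBdd_swap12 (isBdd_swap23 c3)) c4) ?_
  have he : Real.exp (-D / 4) * (n : ℝ) ^ 2 = (n : ℝ) ^ (-(β + 1)) := by
    have e1 : Real.exp (-D / 4) = (n : ℝ) ^ (-(β + 3)) := by
      rw [Real.rpow_def_of_pos kn0, hD]; congr 1; ring
    rw [e1, ← Real.rpow_natCast (n : ℝ) 2, ← Real.rpow_add kn0]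
    congr 1; push_cast; ring
  rw [← he]
  have hex := Real.exp_pos (-D / 4)
  set ee := Real.exp (-D / 4)
  have hrn : (r : ℝ) ≤ n := hrn₁.trans q₁
  have hrn2 : (r : ℝ) ≤ (n : ℝ) ^ 2 := by nlinarith
  have prod_le : ∀ x y : ℝ, 0 ≤ x → 0 ≤ y → x ≤ n → y ≤ n → x * y ≤ (n : ℝ) ^ 2 := by
    intro x y hx hy h1 h2
    rw [sq]; gcongr
  have t1 := prod_le r n₁ kr.le k₁.le hrn q₁
  have t2 := prod_le r n₂ kr.le k₂.le hrn q₂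
  have t3 := prod_le r n₃ kr.le k₃.le hrn q₃
  have t4 := prod_le n₁ n₂ k₁.le k₂.le q₁ q₂
  have t5 := prod_le n₁ n₃ k₁.le k₃.le q₁ q₃
  have t6 := prod_le n₂ n₃ k₂.le k₃.le q₂ q₃
  have kn2 : (0 : ℝ) < (n : ℝ) ^ 2 := by positivity
  calc _ = ee * (2 * ((r * n₃ + r + n₁ * n₂) + (r * n₂ + r + n₁ * n₃) +
        (r * n₁ + r + n₂ * n₃) + r : ℝ)) := by ring
    _ < ee * (100 * (n : ℝ) ^ 2) := mul_lt_mul_of_pos_left (by linarith) hex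
    _ = _ := by ring
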